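/- A unit u of O_L satisfies τ(u)·u = 1 if and only if u = u₀^k or u = -u₀^k for some integer k; that is, the group U₀ = {u ∈ O_L^× : τ(u)·u = 1} equals {± u₀^k : k ∈ ℤ}. -/

import Mathlib

open IntermediateField Polynomial

noncomputable def alpha : ℝ := (2 : ℝ) ^ ((1 : ℝ) / 4)

noncomputable def L : IntermediateField ℚ ℝ := ℚ⟮alpha⟯

noncomputable def alphaL : L := ⟨alpha, IntermediateField.mem_adjoin_simple_self ℚ alpha⟩

noncomputable def u0 : L := (3 + 2 * alphaL ^ 2) + (2 + 2 * alphaL ^ 2) * alphaL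

lemma alpha_pos : 0 < alpha := by unfold alpha; positivity

lemma alpha_four : alpha ^ 4 = 2 := by
  unfold alpha
  rw [← Real.rpow_natCast, ← Real.rpow_mul (by norm_num)]
  norm_num

lemma alpha_sq : alpha ^ 2 = √2 := by
  rw [eq_comm, Real.sqrt_eq_iff_mul_self_eq (by norm_num) (by positivity)]
  rw [← alpha_four]; ring

lemma alphaL_four : alphaL ^ 4 = 2 := by
  apply Subtype.ext
  exact alpha_four

lemma irr_zero (A B : ℚ) (h : (A : ℝ) + B * √2 = 0) : A = 0 ∧ B = 0 := by
  have hB : B = 0 := by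
    by_contra hB
    apply irrational_sqrt_two
    refine ⟨-A / B, ?_⟩
    have : (B : ℝ) ≠ 0 := by exact_mod_cast hB
    push_cast
    field_simp
    linarith
  subst hB
  simpa using h

lemma conj_integral (p q : ℚ) (h : IsIntegral ℤ ((p : ℝ) + q * √2)) :
    IsIntegral ℤ ((p : ℝ) - q * √2) := by
  obtain ⟨f, hf, h0⟩ := h
  refine ⟨f, hf, ?_⟩
  have h2 : √2 * √2 = (2 : ℝ) := Real.mul_self_sqrt (by norm_num)
  have key : ∀ g : ℤ[X], ∃ A B : ℚ,
      eval₂ (algebraMap ℤ ℝ) ((p : ℝ) + q * √2) g = A + B * √2 ∧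
      eval₂ (algebraMap ℤ ℝ) ((p : ℝ) - q * √2) g = A - B * √2 := by
    intro g
    induction g using Polynomial.induction_on with
    | C a => exact ⟨a, 0, by rw [eval₂_C]; simp, by rw [eval₂_C]; simp⟩
    | add f g hf hg =>
      obtain ⟨A, B, h1, h1'⟩ := hf
      obtain ⟨C, D, h3, h3'⟩ := hg
      refine ⟨A + C, B + D, ?_, ?_⟩
      · rw [eval₂_add, h1, h3]; push_cast; ring
      · rw [eval₂_add, h1', h3']; push_cast; ring
    | monomial n a ih =>
      obtain ⟨A, B, h1, h1'⟩ := ih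
      refine ⟨A * p + 2 * B * q, A * q + B * p, ?_, ?_⟩
      · rw [pow_succ, ← mul_assoc, eval₂_mul, h1, eval₂_X]; push_cast
        linear_combination (B * q : ℝ) * h2
      · rw [pow_succ, ← mul_assoc, eval₂_mul, h1', eval₂_X]; push_cast
        linear_combination (B * q : ℝ) * h2
  obtain ⟨A, B, h1, h1'⟩ := key f
  rw [h0] at h1
  obtain ⟨rfl, rfl⟩ := irr_zero A B h1.symm
  rw [h1']; simp

lemma rat_int (r : ℚ) (h : IsIntegral ℤ (r : ℝ)) : ∃ n : ℤ, r = n := by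
  have h' : IsIntegral ℤ r := by
    have : IsIntegral ℤ (algebraMap ℚ ℝ r) := by simpa using h
    exact (isIntegral_algebraMap_iff (algebraMap ℚ ℝ).injective).1 this
  obtain ⟨n, hn⟩ := IsIntegrallyClosed.isIntegral_iff.1 h'
  exact ⟨n, by simpa using hn.symm⟩

lemma rat_int_of_sq (r : ℚ) (m : ℤ) (h : r ^ 2 = m) : ∃ n : ℤ, r = n := by
  apply rat_int
  refine IsIntegral.of_pow (n := 2) (by norm_num) ?_
  have : ((r : ℝ)) ^ 2 = ((m : ℤ) : ℝ) := by exact_mod_cast h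
  rw [this]
  exact isIntegral_algebraMap (R := ℤ) (A := ℝ) (x := m)

lemma even_of_sq {a b : ℤ} (h : a ^ 2 = 2 * b) : ∃ c, a = 2 * c := by
  have : Even (a ^ 2) := ⟨b, by omega⟩
  have := (Int.even_pow.1 this).1
  obtain ⟨c, hc⟩ := this
  exact ⟨c, by omega⟩

lemma quad_int (p q : ℚ) (h : IsIntegral ℤ ((p : ℝ) + q * √2)) :
    (∃ m : ℤ, p = m) ∧ ∃ n : ℤ, q = n := by
  have h2 : √2 * √2 = (2 : ℝ) := Real.mul_self_sqrt (by norm_num)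
  have h' := conj_integral p q h
  obtain ⟨P, hP⟩ := rat_int (2 * p) (by
    have e := h.add h'
    have e2 : ((p : ℝ) + q * √2) + (p - q * √2) = ((2 * p : ℚ) : ℝ) := by push_cast; ring
    rwa [e2] at e)
  obtain ⟨N, hN⟩ := rat_int (p ^ 2 - 2 * q ^ 2) (by
    have e := h.mul h'
    have e2 : ((p : ℝ) + q * √2) * (p - q * √2) = ((p ^ 2 - 2 * q ^ 2 : ℚ) : ℝ) := by
      push_cast; linear_combination (-q ^ 2 : ℝ) * h2
    rwa [e2] at e)
  obtain ⟨R, hR⟩ := rat_int_of_sq (4 * q) (2 * (P ^ 2 - 4 * N)) (by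
    push_cast; rw [← hP, ← hN]; ring)
  have e1 : R ^ 2 = 2 * (P ^ 2 - 4 * N) := by
    have : (R : ℚ) ^ 2 = 2 * (P ^ 2 - 4 * N) := by rw [← hP, ← hN, ← hR]; ring
    exact_mod_cast this
  obtain ⟨Q, rfl⟩ := even_of_sq e1
  obtain ⟨P', rfl⟩ := even_of_sq (a := P) (b := Q ^ 2 + 2 * N) (by linarith)
  obtain ⟨Q', rfl⟩ := even_of_sq (a := Q) (b := P' ^ 2 - N) (by linarith)
  push_cast at hP hR
  exact ⟨⟨P', by linarith⟩, ⟨Q', by linarith⟩⟩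

lemma form (u : L) : ∃ a b c d : ℚ, u = (a : L) + b * alphaL + c * alphaL ^ 2 + d * alphaL ^ 3 := by
  have hint : IsAlgebraic ℚ alpha := by
    refine ⟨X ^ 4 - C 2, ?_, ?_⟩
    · exact (monic_X_pow_sub_C 2 (by norm_num)).ne_zero
    · simp [alpha_four]
  have key : ∀ x ∈ Algebra.adjoin ℚ {alpha}, ∃ a b c d : ℚ,
      x = (a : ℝ) + b * alpha + c * alpha ^ 2 + d * alpha ^ 3 := by
    intro x hx
    induction hx using Algebra.adjoin_induction with
    | mem x hx => 
      rw [Set.mem_singleton_iff] at hx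
      exact ⟨0, 1, 0, 0, by simp [hx]⟩
    | algebraMap r => exact ⟨r, 0, 0, 0, by simp⟩
    | add x y _ _ hx hy =>
      obtain ⟨a, b, c, d, rfl⟩ := hx
      obtain ⟨a', b', c', d', rfl⟩ := hy
      exact ⟨a + a', b + b', c + c', d + d', by push_cast; ring⟩
    | mul x y _ _ hx hy =>
      obtain ⟨a, b, c, d, rfl⟩ := hx
      obtain ⟨a', b', c', d', rfl⟩ := hy
      refine ⟨a * a' + 2 * (b * d' + c * c' + d * b'),
        a * b' + b * a' + 2 * (c * d' + d * c'),
        a * c' + b * b' + c * a' + 2 * (d * d'),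
        a * d' + b * c' + c * b' + d * a', ?_⟩
      push_cast
      linear_combination ((b * d' + c * c' + d * b' : ℝ) + (c * d' + d * c') * alpha
        + d * d' * alpha ^ 2) * alpha_four
  have hu : (u : ℝ) ∈ Algebra.adjoin ℚ {alpha} := by
    rw [← IntermediateField.adjoin_simple_toSubalgebra_of_isAlgebraic hint]
    exact u.2
  obtain ⟨a, b, c, d, h⟩ := key _ hu
  refine ⟨a, b, c, d, Subtype.ext ?_⟩
  rw [h]
  push_cast
  rfl

lemma coords (τ : L ≃ₐ[ℚ] L) (hτ : τ alphaL = -alphaL) (u : L) (hu : IsIntegral ℤ u)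
    (h1 : τ u * u = 1) : ∃ a b c d : ℤ,
      (u : ℝ) = (a : ℝ) + b * alpha + c * alpha ^ 2 + d * alpha ^ 3 ∧
      a ^ 2 + 2 * c ^ 2 - 4 * b * d = 1 ∧ 2 * a * c = b ^ 2 + 2 * d ^ 2 := by
  obtain ⟨a, b, c, d, h⟩ := form u
  have ht : τ u = (a : L) - b * alphaL + c * alphaL ^ 2 - d * alphaL ^ 3 := by
    rw [h]; simp only [map_add, map_mul, map_pow, hτ, map_ratCast]; ring
  have hut : IsIntegral ℤ (τ u) := hu.map (τ.toAlgHom.restrictScalars ℤ)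
  have hα : IsIntegral ℤ alphaL := by
    refine IsIntegral.of_pow (n := 4) (by norm_num) ?_
    rw [alphaL_four]
    exact isIntegral_algebraMap (R := ℤ) (A := L) (x := 2)
  have toR : ∀ x : L, IsIntegral ℤ x → IsIntegral ℤ (x : ℝ) := fun x hx =>
    hx.map (L.val.restrictScalars ℤ)
  have hc : ((alphaL : L) : ℝ) = alpha := rfl
  have huR : (u : ℝ) = (a : ℝ) + b * alpha + c * alpha ^ 2 + d * alpha ^ 3 := by
    rw [h]; push_cast; rfl
  have htR : (τ u : ℝ) = (a : ℝ) - b * alpha + c * alpha ^ 2 - d * alpha ^ 3 := by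
    rw [ht]; push_cast; rfl
  have h1R : (τ u : ℝ) * u = 1 := by
    have := congrArg (fun x : L => (x : ℝ)) h1
    simpa using this
  obtain ⟨⟨m, hm⟩, n, hn⟩ := quad_int (2 * a) (2 * c) (by
    have := toR _ (hu.add hut)
    convert this using 1
    push_cast
    rw [huR, htR, ← alpha_sq]; ring)
  obtain ⟨⟨l, hl⟩, k, hk⟩ := quad_int (4 * d) (2 * b) (by
    have := toR _ (hα.mul (hu.sub hut))
    convert this using 1
    push_cast
    rw [huR, htR, ← alpha_sq, hc]
    linear_combination (-2 * d : ℝ) * alpha_four)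
  obtain ⟨e1, e2⟩ := irr_zero (a ^ 2 + 2 * c ^ 2 - 4 * b * d - 1) (2 * a * c - b ^ 2 - 2 * d ^ 2) (by
    rw [htR, huR] at h1R
    push_cast
    rw [← alpha_sq]
    linear_combination h1R + (-c ^ 2 + 2 * b * d + d ^ 2 * alpha ^ 2 : ℝ) * alpha_four)
  have f1 : m ^ 2 + 2 * n ^ 2 - 2 * k * l = 4 := by
    have : (m : ℚ) ^ 2 + 2 * n ^ 2 - 2 * k * l = 4 := by
      rw [← hm, ← hn, ← hk, ← hl]; linear_combination 4 * e1
    exact_mod_cast this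
  have f2 : 4 * m * n = 2 * k ^ 2 + l ^ 2 := by
    have : 4 * (m : ℚ) * n = 2 * k ^ 2 + l ^ 2 := by
      rw [← hm, ← hn, ← hk, ← hl]; linear_combination 8 * e2
    exact_mod_cast this
  obtain ⟨l, rfl⟩ := even_of_sq (a := l) (b := 2 * m * n - k ^ 2) (by linarith)
  obtain ⟨m, rfl⟩ := even_of_sq (a := m) (b := 2 - n ^ 2 + 2 * k * l) (by linarith)
  obtain ⟨k, rfl⟩ := even_of_sq (a := k) (b := 2 * m * n - l ^ 2) (by linarith)
  obtain ⟨n, rfl⟩ := even_of_sq (a := n) (b := 1 - m ^ 2 + 2 * k * l) (by linarith)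
  obtain ⟨l, rfl⟩ := even_of_sq (a := l) (b := 2 * m * n - k ^ 2) (by linarith)
  push_cast at hm hn hk hl
  have ha : a = m := by linarith
  have hb : b = k := by linarith
  have hc : c = n := by linarith
  have hd : d = l := by linarith
  subst ha hb hc hd
  refine ⟨m, k, n, l, ?_, by linarith, by linarith⟩
  rw [huR]; push_cast; ring

set_option maxHeartbeats 1000000 in
lemma small (a b c d : ℤ) (u : ℝ)
    (hu : u = (a : ℝ) + b * alpha + c * alpha ^ 2 + d * alpha ^ 3)
    (e1 : a ^ 2 + 2 * c ^ 2 - 4 * b * d = 1) (e2 : 2 * a * c = b ^ 2 + 2 * d ^ 2)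
    (h1 : 1 ≤ u) (h2 : u < (u0 : ℝ)) : u = 1 := by
  have hu0 : (u0 : ℝ) = (3 + 2 * alpha ^ 2) + (2 + 2 * alpha ^ 2) * alpha := by
    unfold u0; push_cast; rfl
  obtain ⟨w, hw⟩ : ∃ w, w = alpha ^ 2 := ⟨_, rfl⟩
  have hw0 : 0 < w := by rw [hw]; have := alpha_pos; positivity
  have hww : w ^ 2 = 2 := by rw [hw, ← alpha_four]; ring
  have w1 : 1.414 < w := by nlinarith
  have w2 : w < 1.415 := by nlinarith
  have a0 := alpha_pos
  have a1 : 1.189 < alpha := by nlinarith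
  have a2 : alpha < 1.19 := by nlinarith
  have E1 : (a : ℝ) ^ 2 + 2 * c ^ 2 - 4 * b * d = 1 := by exact_mod_cast e1
  have E2 : 2 * (a : ℝ) * c = b ^ 2 + 2 * d ^ 2 := by exact_mod_cast e2
  obtain ⟨x, hx⟩ : ∃ x : ℝ, x = a + c * w := ⟨_, rfl⟩
  obtain ⟨y, hy⟩ : ∃ y : ℝ, y = b + d * w := ⟨_, rfl⟩
  obtain ⟨x', hx'⟩ : ∃ x : ℝ, x = a - c * w := ⟨_, rfl⟩
  obtain ⟨y', hy'⟩ : ∃ y : ℝ, y = b - d * w := ⟨_, rfl⟩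
  have hu' : u = x + y * alpha := by rw [hu, hx, hy, hw]; ring
  have n1 : x ^ 2 - w * y ^ 2 = 1 := by
    rw [hx, hy]
    linear_combination E1 + w * E2 + (c ^ 2 - 2 * b * d - d ^ 2 * w : ℝ) * hww
  have n2 : x' ^ 2 + w * y' ^ 2 = 1 := by
    rw [hx', hy']
    linear_combination E1 - w * E2 + (c ^ 2 - 2 * b * d + d ^ 2 * w : ℝ) * hww
  obtain ⟨v, hv⟩ : ∃ v, v = x - y * alpha := ⟨_, rfl⟩
  have huv : u * v = 1 := by
    rw [hu', hv]; linear_combination n1 + y ^ 2 * hw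
  have v0 : 0 < v := pos_of_mul_pos_right (by rw [huv]; norm_num) (by linarith)
  have v1 : v ≤ 1 := by
    have := mul_le_mul_of_nonneg_right h1 v0.le
    linarith
  have hU : u < 11.6 := by
    rw [hu0, ← hw] at h2
    have : (2 + 2 * w) * alpha ≤ 4.83 * 1.19 :=
      mul_le_mul (by linarith) a2.le a0.le (by norm_num)
    linarith
  have y0 : 0 ≤ y := by
    have : 0 ≤ y * alpha := by linarith
    exact nonneg_of_mul_nonneg_left this a0
  have y1 : y < 4.9 := by
    have h3 : y * 1.189 ≤ y * alpha := mul_le_mul_of_nonneg_left a1.le y0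
    linarith
  have x0 : 0 < x := by linarith
  have x1 : x < 6.3 := by linarith
  have hx2 : x' ^ 2 ≤ 1 ^ 2 := by linarith [mul_nonneg hw0.le (sq_nonneg y')]
  obtain ⟨xLo, xUp⟩ := abs_le.1 (abs_le_of_sq_le_sq hx2 (by norm_num))
  have hy2 : y' ^ 2 ≤ 0.9 ^ 2 := by
    have h3 : 1.414 * y' ^ 2 ≤ w * y' ^ 2 := mul_le_mul_of_nonneg_right w1.le (sq_nonneg _)
    linarith [sq_nonneg x']
  obtain ⟨yLo, yUp⟩ := abs_le.1 (abs_le_of_sq_le_sq hy2 (by norm_num))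
  have hcw : 2 * (c * w) = x - x' := by rw [hx, hx']; ring
  have hdw : 2 * (d * w) = y - y' := by rw [hy, hy']; ring
  have A1 : a < 4 := by
    have : (a : ℝ) < 4 := by linarith
    exact_mod_cast this
  have A0 : -1 < a := by
    have : (-1 : ℝ) < a := by linarith
    exact_mod_cast this
  have B1 : b < 3 := by
    have : (b : ℝ) < 3 := by linarith
    exact_mod_cast this
  have B0 : -1 < b := by
    have : (-1 : ℝ) < b := by linarith
    exact_mod_cast this
  have C1 : c < 3 := by
    have : (c : ℝ) < 3 := by
      by_contra hh
      have := mul_le_mul_of_nonneg_right (not_lt.1 hh) hw0.le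
      linarith
    exact_mod_cast this
  have C0 : -1 < c := by
    have : (-1 : ℝ) < c := by
      by_contra hh
      have := mul_le_mul_of_nonneg_right (not_lt.1 hh) hw0.le
      linarith
    exact_mod_cast this
  have D1 : d < 3 := by
    have : (d : ℝ) < 3 := by
      by_contra hh
      have := mul_le_mul_of_nonneg_right (not_lt.1 hh) hw0.le
      linarith
    exact_mod_cast this
  have D0 : -1 < d := by
    have : (-1 : ℝ) < d := by
      by_contra hh
      have := mul_le_mul_of_nonneg_right (not_lt.1 hh) hw0.le
      linarith
    exact_mod_cast this
  have fin : (a = 1 ∧ b = 0 ∧ c = 0 ∧ d = 0) ∨ (a = 3 ∧ b = 2 ∧ c = 2 ∧ d = 2) := by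
    clear * - A0 A1 B0 B1 C0 C1 D0 D1 e1 e2
    interval_cases a <;> interval_cases c <;> interval_cases b <;> interval_cases d <;> omega
  rcases fin with ⟨rfl, rfl, rfl, rfl⟩ | ⟨rfl, rfl, rfl, rfl⟩
  · rw [hu]; simp
  · exfalso
    apply h2.ne
    rw [hu, hu0]; push_cast; ring

/-- The group `U₀ = {u ∈ O_L^× : τ(u)·u = 1}` equals `{± u₀^k : k ∈ ℤ}`. -/
theorem stmt2 (τ : L ≃ₐ[ℚ] L) (hτ : τ alphaL = -alphaL) :
    {u : L | IsIntegral ℤ u ∧ (∃ w : L, IsIntegral ℤ w ∧ u * w = 1) ∧ τ u * u = 1}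
      = {u : L | ∃ k : ℤ, u = u0 ^ k ∨ u = -u0 ^ k} := by
  have hα : IsIntegral ℤ alphaL := by
    refine IsIntegral.of_pow (n := 4) (by norm_num) ?_
    rw [alphaL_four]
    exact isIntegral_algebraMap (R := ℤ) (A := L) (x := 2)
  have hI : ∀ n : ℤ, IsIntegral ℤ (n : L) := fun n =>
    isIntegral_algebraMap (R := ℤ) (A := L) (x := n)
  have hτI : ∀ u : L, IsIntegral ℤ u → IsIntegral ℤ (τ u) := fun u hu =>
    hu.map (τ.toAlgHom.restrictScalars ℤ)
  have i0 : IsIntegral ℤ u0 := by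
    have := ((hI 3).add ((hI 2).mul (hα.pow 2))).add
      (((hI 2).add ((hI 2).mul (hα.pow 2))).mul hα)
    unfold u0
    exact_mod_cast this
  have t0' : τ u0 = (3 + 2 * alphaL ^ 2) - (2 + 2 * alphaL ^ 2) * alphaL := by
    unfold u0
    simp only [map_add, map_mul, map_pow, hτ, map_ofNat]; ring
  have t0 : τ u0 * u0 = 1 := by
    rw [t0']; unfold u0
    linear_combination (-4 - 4 * alphaL ^ 2) * alphaL_four
  have ne0 : u0 ≠ 0 := right_ne_zero_of_mul_eq_one t0
  have inv0 : u0⁻¹ = τ u0 := (eq_inv_of_mul_eq_one_left t0).symm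
  have iz : ∀ k : ℤ, IsIntegral ℤ (u0 ^ k) := by
    intro k
    obtain ⟨n, rfl | rfl⟩ := k.eq_nat_or_neg
    · rw [zpow_natCast]; exact i0.pow n
    · rw [zpow_neg, zpow_natCast, ← inv_pow, inv0]; exact (hτI _ i0).pow n
  have tz : ∀ k : ℤ, τ (u0 ^ k) * u0 ^ k = 1 := by
    intro k
    rw [map_zpow₀, ← mul_zpow, t0, one_zpow]
  have hu0R : (1 : ℝ) < (u0 : ℝ) := by
    have : (u0 : ℝ) = (3 + 2 * alpha ^ 2) + (2 + 2 * alpha ^ 2) * alpha := by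
      unfold u0; push_cast; rfl
    have h := alpha_pos
    have : 0 < (2 + 2 * alpha ^ 2) * alpha := by positivity
    nlinarith
  have pos : ∀ u : L, IsIntegral ℤ u → τ u * u = 1 → 0 < (u : ℝ) → ∃ k : ℤ, u = u0 ^ k := by
    intro u hu ht hp
    obtain ⟨k, hk1, hk2⟩ := exists_mem_Ico_zpow hp hu0R
    refine ⟨k, ?_⟩
    have hpk : (0 : ℝ) < (u0 : ℝ) ^ k := by positivity
    obtain ⟨a, b, c, d, h, e1, e2⟩ := coords τ hτ (u * u0 ^ (-k)) (hu.mul (iz _)) (by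
      rw [map_mul]
      linear_combination (τ (u0 ^ (-k)) * u0 ^ (-k)) * ht + tz (-k))
    have hv : ((u * u0 ^ (-k) : L) : ℝ) = u / (u0 : ℝ) ^ k := by
      rw [zpow_neg]; push_cast; rw [div_eq_mul_inv]; rfl
    have := small a b c d _ h e1 e2 (by rw [hv, le_div_iff₀ hpk]; linarith)
      (by rw [hv, div_lt_iff₀ hpk, mul_comm, ← zpow_add_one₀ (by positivity)]; exact hk2)
    rw [hv, div_eq_one_iff_eq hpk.ne'] at this
    apply Subtype.ext
    rw [this]; push_cast; rfl
  ext u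
  simp only [Set.mem_setOf_eq]
  constructor
  · rintro ⟨hu, -, ht⟩
    have hne : (u : ℝ) ≠ 0 := by
      have := right_ne_zero_of_mul_eq_one ht
      simpa using this
    rcases hne.lt_or_gt with hn | hp
    · obtain ⟨k, hk⟩ := pos (-u) hu.neg (by rw [map_neg]; linear_combination ht)
        (by push_cast; linarith)
      exact ⟨k, Or.inr (by rw [← hk, neg_neg])⟩
    · obtain ⟨k, hk⟩ := pos u hu ht hp
      exact ⟨k, Or.inl hk⟩
  · have fin : ∀ u : L, IsIntegral ℤ u → τ u * u = 1 →
        IsIntegral ℤ u ∧ (∃ w : L, IsIntegral ℤ w ∧ u * w = 1) ∧ τ u * u = 1 :=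
      fun u hu ht => ⟨hu, ⟨τ u, hτI u hu, by rw [mul_comm]; exact ht⟩, ht⟩
    rintro ⟨k, rfl | rfl⟩
    · exact fin _ (iz k) (tz k)
    · exact fin _ (iz k).neg (by rw [map_neg]; linear_combination tz k)
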